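/- Let X be a Banach space having Fourier type p for some p ∈ (1,2] with constant c_p, and let δ > 0 and λ > 0. Then there exist constants b(λ,δ) > 0 and B(λ,δ) > 0, depending only on λ, δ, p and c_p, such that for every finite interval w ⊂ ℝ and every strongly measurable f : w → X with (1/|w|)∫_w ‖f(x)‖_X (log⁺‖f(x)‖_X)^{1+δ} dx ≤ λ, one has Σ_{k∈ℤ} exp( −b(λ,δ) · C_k(f,w)^{−1/(1+δ)} ) ≤ B(λ,δ), with the convention that a summand is 0 when C_k(f,w) = 0. -/

import Mathlib

open MeasureTheory Filter Set Topology Real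
open scoped ENNReal NNReal

noncomputable section

universe u
section
variable {X : Type*} [NormedAddCommGroup X] [NormedSpace ℂ X]

/-- Generalized Fourier coefficient on the interval `w = (a,b)`:
`f̂_w(α) = (1/|w|) ∫_w f(t) e^{-2πiαt/|w|} dt`. -/
def intervalFourierCoeff (f : ℝ → X) (a b : ℝ) (α : ℝ) : X :=
  (b - a)⁻¹ • ∫ t in Ioo a b,
    Complex.exp (-(2 * (π : ℂ) * Complex.I * (α : ℂ) * (t : ℂ)) / ((b : ℂ) - (a : ℂ))) • f t

/-- `X` has Fourier type `p` with constant `c`. -/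
def HasFourierTypeWith (X : Type*) [NormedAddCommGroup X] [NormedSpace ℂ X]
    (p c : ℝ) : Prop :=
  ∀ a b : ℝ, a < b → ∀ f : ℝ → X, AEStronglyMeasurable f (volume.restrict (Ioo a b)) →
    (∑' k : ℤ, (‖intervalFourierCoeff f a b k‖₊ : ℝ≥0∞) ^ (p / (p - 1))) ^ ((p - 1) / p)
      ≤ ENNReal.ofReal c *
        ((ENNReal.ofReal (b - a))⁻¹ * ∫⁻ t in Ioo a b, (‖f t‖₊ : ℝ≥0∞) ^ p) ^ (1 / p)

/-- `log⁺ u = max (log u) 0`. -/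
def logPlus (u : ℝ) : ℝ := max (Real.log u) 0

/-- The normalized `L (log L)^β` "norm" `(1/|w|) ∫_w ‖f‖ (log⁺‖f‖)^β` on `w = (a,b)`. -/
def avgLlogL (f : ℝ → X) (β a b : ℝ) : ℝ≥0∞ :=
  (ENNReal.ofReal (b - a))⁻¹ *
    ∫⁻ x in Ioo a b, ENNReal.ofReal (‖f x‖ * logPlus ‖f x‖ ^ β)

/-- Carleson average `C_k(f,w) = γ⁻¹ Σ_μ ‖f̂_w(k+μ/3)‖/(1+μ²)`. -/
def carlesonAvg (f : ℝ → X) (a b : ℝ) (k : ℤ) : ℝ :=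
  (∑' μ : ℤ, (1 + (μ : ℝ) ^ 2)⁻¹)⁻¹ *
    ∑' μ : ℤ, ‖intervalFourierCoeff f a b ((k : ℝ) + (μ : ℝ) / 3)‖ / (1 + (μ : ℝ) ^ 2)
end

/-- `exp(-b t^{-1/β})`, with the convention that it is `0` when `t = 0`. -/
def expWeight (b β t : ℝ) : ℝ :=
  if t = 0 then 0 else Real.exp (-b * t ^ (-(1 / β)))

section
variable {X : Type*} [NormedAddCommGroup X]

/-- The truncation of `f` to the set where `‖f‖ ≤ M`. -/
def normTruncation (f : ℝ → X) (M : ℝ) : ℝ → X :=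
  indicator {x | ‖f x‖ ≤ M} f

lemma norm_normTruncation_le (f : ℝ → X) {M : ℝ} (hM : 0 ≤ M) (x : ℝ) :
    ‖normTruncation f M x‖ ≤ M := by
  by_cases h : ‖f x‖ ≤ M
  · simp [normTruncation, indicator, h]
  · simp [normTruncation, indicator, h, hM]

lemma aestronglyMeasurable_normTruncation {ν : Measure ℝ} {f : ℝ → X}
    (hf : AEStronglyMeasurable f ν) (M : ℝ) : AEStronglyMeasurable (normTruncation f M) ν :=
  hf.indicator₀ (nullMeasurableSet_le hf.norm.aemeasurable aemeasurable_const)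

lemma enorm_sub_normTruncation_le (f : ℝ → X) {β : ℝ} (hβ : 0 < β) {s : ℝ} (hs : 0 < s) (x : ℝ) :
    ‖f x - normTruncation f (Real.exp s) x‖ₑ ≤
      ENNReal.ofReal (s ^ β)⁻¹ * ENNReal.ofReal (‖f x‖ * logPlus ‖f x‖ ^ β) := by
  by_cases h : ‖f x‖ ≤ Real.exp s
  · simp [normTruncation, indicator, h]
  · have hlog : s ≤ logPlus ‖f x‖ := by
      refine le_max_of_le_left ?_
      rw [Real.le_log_iff_exp_le ((Real.exp_pos s).trans (not_le.1 h))]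
      exact (not_le.1 h).le
    have hpow : s ^ β ≤ logPlus ‖f x‖ ^ β := Real.rpow_le_rpow hs.le hlog hβ.le
    have hspos : 0 < s ^ β := by positivity
    have hz : normTruncation f (Real.exp s) x = 0 := by simp [normTruncation, indicator, h]
    rw [hz, sub_zero, ← ofReal_norm, ← ENNReal.ofReal_mul (by positivity)]
    refine ENNReal.ofReal_le_ofReal ?_
    rw [inv_mul_eq_div, le_div_iff₀ hspos]
    gcongr

end

section
variable {X : Type*} [NormedAddCommGroup X] [NormedSpace ℂ X]

/-- The modulating exponential in `intervalFourierCoeff`. -/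
def intervalChar (a b α t : ℝ) : ℂ :=
  Complex.exp (-(2 * (π : ℂ) * Complex.I * (α : ℂ) * (t : ℂ)) / ((b : ℂ) - (a : ℂ)))

lemma intervalFourierCoeff_eq (f : ℝ → X) (a b α : ℝ) :
    intervalFourierCoeff f a b α = (b - a)⁻¹ • ∫ t in Ioo a b, intervalChar a b α t • f t :=
  rfl

lemma norm_intervalChar (a b α t : ℝ) : ‖intervalChar a b α t‖ = 1 := by
  have h : -(2 * (π : ℂ) * Complex.I * (α : ℂ) * (t : ℂ)) / ((b : ℂ) - (a : ℂ)) =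
      ((-(2 * π * α * t) / (b - a) : ℝ) : ℂ) * Complex.I := by
    push_cast
    ring
  rw [intervalChar, h, Complex.norm_exp_ofReal_mul_I]

lemma continuous_intervalChar (a b α : ℝ) : Continuous (intervalChar a b α) := by
  unfold intervalChar
  fun_prop

lemma intervalChar_add (a b α β t : ℝ) :
    intervalChar a b (α + β) t = intervalChar a b α t * intervalChar a b β t := by
  rw [intervalChar, intervalChar, intervalChar, ← Complex.exp_add]
  congr 1
  push_cast
  ring

lemma intervalFourierCoeff_add (f : ℝ → X) (a b α β : ℝ) :
    intervalFourierCoeff f a b (α + β) =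
      intervalFourierCoeff (fun t => intervalChar a b β t • f t) a b α := by
  simp only [intervalFourierCoeff_eq, intervalChar_add, mul_smul]

lemma inv_ofReal_mul_lintegral_le {a b : ℝ} (hab : a < b) {g : ℝ → ℝ≥0∞} {K : ℝ≥0∞}
    (h : ∀ x, g x ≤ K) : (ENNReal.ofReal (b - a))⁻¹ * ∫⁻ t in Ioo a b, g t ≤ K := by
  have h0 : ENNReal.ofReal (b - a) ≠ 0 := by simpa using hab
  calc (ENNReal.ofReal (b - a))⁻¹ * ∫⁻ t in Ioo a b, g t
      ≤ (ENNReal.ofReal (b - a))⁻¹ * ∫⁻ _ in Ioo a b, K := by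
        gcongr with t
        exact h t
    _ = K := by
        rw [setLIntegral_const, Real.volume_Ioo, mul_comm K, ← mul_assoc,
          ENNReal.inv_mul_cancel h0 ENNReal.ofReal_ne_top, one_mul]

lemma HasFourierTypeWith.tsum_rpow_le {p c : ℝ} (hX : HasFourierTypeWith X p c) (hp : 1 < p)
    (hc : 0 ≤ c) {a b : ℝ} (hab : a < b) {f : ℝ → X}
    (hf : AEStronglyMeasurable f (volume.restrict (Ioo a b))) {M : ℝ}
    (hfM : ∀ x, ‖f x‖ ≤ M) (α : ℝ) :
    ∑' k : ℤ, ‖intervalFourierCoeff f a b (k + α)‖ₑ ^ (p / (p - 1)) ≤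
      ENNReal.ofReal (c * M) ^ (p / (p - 1)) := by
  have hp0 : 0 < p := by linarith
  have hp1 : 0 < p - 1 := by linarith
  have key := hX a b hab (fun t => intervalChar a b α t • f t)
    ((continuous_intervalChar a b α).aestronglyMeasurable.smul hf)
  simp only [← intervalFourierCoeff_add] at key
  have hbound : ((ENNReal.ofReal (b - a))⁻¹ * ∫⁻ t in Ioo a b,
      (‖intervalChar a b α t • f t‖₊ : ℝ≥0∞) ^ p) ^ (1 / p) ≤ ENNReal.ofReal M := by
    have hM : ∀ t, (‖intervalChar a b α t • f t‖₊ : ℝ≥0∞) ^ p ≤ ENNReal.ofReal M ^ p := by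
      intro t
      refine ENNReal.rpow_le_rpow ?_ hp0.le
      rw [← enorm_eq_nnnorm, ← ofReal_norm, norm_smul, norm_intervalChar, one_mul]
      exact ENNReal.ofReal_le_ofReal (hfM t)
    refine (ENNReal.rpow_le_rpow (inv_ofReal_mul_lintegral_le hab hM) (by positivity)).trans_eq ?_
    rw [← ENNReal.rpow_mul, mul_one_div_cancel hp0.ne', ENNReal.rpow_one]
  have h2 := key.trans (mul_le_mul_right hbound _)
  rw [← ENNReal.ofReal_mul hc] at h2
  have h3 := ENNReal.rpow_le_rpow h2 (by positivity : 0 ≤ p / (p - 1))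
  rwa [← ENNReal.rpow_mul, div_mul_div_comm, mul_comm (p - 1) p, div_self (by positivity),
    ENNReal.rpow_one] at h3

lemma enorm_intervalFourierCoeff_le_add {a b : ℝ} (hab : a < b) {f g : ℝ → X}
    (hf : AEStronglyMeasurable f (volume.restrict (Ioo a b)))
    (hg : IntegrableOn g (Ioo a b)) (α : ℝ) :
    ‖intervalFourierCoeff f a b α‖ₑ ≤ ‖intervalFourierCoeff g a b α‖ₑ +
      (ENNReal.ofReal (b - a))⁻¹ * ∫⁻ t in Ioo a b, ‖f t - g t‖ₑ := by
  have hba : 0 < b - a := sub_pos.2 hab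
  have hnorm : ‖(b - a)⁻¹‖ₑ = (ENNReal.ofReal (b - a))⁻¹ := by
    rw [Real.enorm_of_nonneg (by positivity), ENNReal.ofReal_inv_of_pos hba]
  by_cases htop : ∫⁻ t in Ioo a b, ‖f t - g t‖ₑ = ∞
  · rw [htop, ENNReal.mul_top (by simp)]
    simp
  have hchar : ∀ {h : ℝ → X}, IntegrableOn h (Ioo a b) →
      IntegrableOn (fun t => intervalChar a b α t • h t) (Ioo a b) := fun {h} hh =>
    Integrable.bdd_smul hh 1 (continuous_intervalChar a b α).aestronglyMeasurable
      (Eventually.of_forall fun t => (norm_intervalChar a b α t).le)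
  have hfg : IntegrableOn (fun t => f t - g t) (Ioo a b) :=
    ⟨hf.sub hg.aestronglyMeasurable, lt_top_iff_ne_top.2 htop⟩
  have heq : intervalFourierCoeff f a b α = intervalFourierCoeff g a b α +
      intervalFourierCoeff (fun t => f t - g t) a b α := by
    simp only [intervalFourierCoeff_eq]
    rw [← smul_add, ← integral_add (hchar hg) (hchar hfg)]
    simp only [← smul_add, add_sub_cancel]
  rw [heq]
  refine (enorm_add_le _ _).trans (add_le_add_right ?_ _)
  rw [intervalFourierCoeff_eq, enorm_smul, hnorm]
  gcongr
  refine (enorm_integral_le_lintegral_enorm _).trans_eq ?_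
  refine lintegral_congr fun t => ?_
  rw [enorm_smul, ← ofReal_norm (intervalChar a b α t), norm_intervalChar, ENNReal.ofReal_one,
    one_mul]

/-- The normalized weights `γ⁻¹ / (1 + μ²)` of the Carleson average. -/
def carlesonWeight (μ : ℤ) : ℝ≥0∞ :=
  ENNReal.ofReal ((∑' ν : ℤ, (1 + (ν : ℝ) ^ 2)⁻¹)⁻¹ * (1 + (μ : ℝ) ^ 2)⁻¹)

lemma summable_inv_one_add_sq : Summable fun ν : ℤ => (1 + (ν : ℝ) ^ 2)⁻¹ := by
  have h : Summable fun ν : ℤ => 1 / (ν : ℝ) ^ 2 :=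
    Real.summable_one_div_int_pow.2 one_lt_two
  refine Summable.of_norm_bounded_eventually (g := fun ν : ℤ => 1 / (ν : ℝ) ^ 2) h ?_
  filter_upwards [(Set.finite_singleton (0 : ℤ)).compl_mem_cofinite] with ν hν
  have h0 : (ν : ℝ) ≠ 0 := by simpa using hν
  have : 0 < (ν : ℝ) ^ 2 := by positivity
  rw [Real.norm_of_nonneg (by positivity), one_div]
  gcongr
  linarith

lemma tsum_carlesonWeight : ∑' μ, carlesonWeight μ = 1 := by
  have hs := summable_inv_one_add_sq
  have hpos : 0 < ∑' ν : ℤ, (1 + (ν : ℝ) ^ 2)⁻¹ :=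
    hs.tsum_pos (fun ν => by positivity) 0 (by simp)
  simp only [carlesonWeight]
  rw [← ENNReal.ofReal_tsum_of_nonneg (fun μ => by positivity) (hs.mul_left _), tsum_mul_left,
    inv_mul_cancel₀ hpos.ne', ENNReal.ofReal_one]

/-- The Carleson average as an extended nonnegative number. -/
def ecarlesonAvg (f : ℝ → X) (a b : ℝ) (k : ℤ) : ℝ≥0∞ :=
  ∑' μ : ℤ, carlesonWeight μ * ‖intervalFourierCoeff f a b ((k : ℝ) + (μ : ℝ) / 3)‖ₑ

lemma carlesonAvg_nonneg (f : ℝ → X) (a b : ℝ) (k : ℤ) : 0 ≤ carlesonAvg f a b k :=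
  mul_nonneg (inv_nonneg.2 (tsum_nonneg fun _ => by positivity))
    (tsum_nonneg fun _ => by positivity)

lemma ofReal_carlesonAvg_le (f : ℝ → X) (a b : ℝ) (k : ℤ) :
    ENNReal.ofReal (carlesonAvg f a b k) ≤ ecarlesonAvg f a b k := by
  have hγ : 0 ≤ (∑' ν : ℤ, (1 + (ν : ℝ) ^ 2)⁻¹)⁻¹ :=
    inv_nonneg.2 (tsum_nonneg fun _ => by positivity)
  rw [carlesonAvg]
  by_cases hs : Summable fun μ : ℤ =>
      ‖intervalFourierCoeff f a b ((k : ℝ) + (μ : ℝ) / 3)‖ / (1 + (μ : ℝ) ^ 2)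
  · rw [← tsum_mul_left, ENNReal.ofReal_tsum_of_nonneg (fun μ => by positivity) (hs.mul_left _)]
    refine ENNReal.tsum_le_tsum fun μ => le_of_eq ?_
    rw [carlesonWeight, ← ofReal_norm, ← ENNReal.ofReal_mul (by positivity)]
    congr 1
    ring
  · simp [tsum_eq_zero_of_not_summable hs]

lemma ecarlesonAvg_le_add {a b : ℝ} (hab : a < b) {f g : ℝ → X}
    (hf : AEStronglyMeasurable f (volume.restrict (Ioo a b)))
    (hg : IntegrableOn g (Ioo a b)) (k : ℤ) :
    ecarlesonAvg f a b k ≤ ecarlesonAvg g a b k +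
      (ENNReal.ofReal (b - a))⁻¹ * ∫⁻ t in Ioo a b, ‖f t - g t‖ₑ := by
  set D := (ENNReal.ofReal (b - a))⁻¹ * ∫⁻ t in Ioo a b, ‖f t - g t‖ₑ
  calc ecarlesonAvg f a b k
      ≤ ∑' μ : ℤ, carlesonWeight μ *
          (‖intervalFourierCoeff g a b ((k : ℝ) + (μ : ℝ) / 3)‖ₑ + D) :=
        ENNReal.tsum_le_tsum fun μ =>
          mul_le_mul_right (enorm_intervalFourierCoeff_le_add hab hf hg _) _
    _ = ecarlesonAvg g a b k + D := by
        simp only [mul_add]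
        rw [ENNReal.tsum_add, ENNReal.tsum_mul_right, tsum_carlesonWeight, one_mul, ecarlesonAvg]

lemma tsum_mul_rpow_le {ι : Type*} (w x : ι → ℝ≥0∞) (hw : ∑' i, w i ≤ 1) {q : ℝ} (hq : 1 ≤ q) :
    (∑' i, w i * x i) ^ q ≤ ∑' i, w i * x i ^ q := by
  have hq0 : 0 < q := by linarith
  rw [← ENNReal.le_rpow_inv_iff hq0, ENNReal.tsum_eq_iSup_sum]
  refine iSup_le fun s => (ENNReal.inner_le_weight_mul_Lp_of_nonneg s hq w x).trans ?_
  have hw1 : (∑ i ∈ s, w i) ^ (1 - q⁻¹) ≤ 1 :=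
    ENNReal.rpow_le_one ((ENNReal.sum_le_tsum s).trans hw)
      (sub_nonneg.2 (inv_le_one_of_one_le₀ hq))
  refine (mul_le_of_le_one_left' hw1).trans ?_
  gcongr
  exact ENNReal.sum_le_tsum s

lemma HasFourierTypeWith.tsum_ecarlesonAvg_rpow_le {p c : ℝ} (hX : HasFourierTypeWith X p c)
    (hp : 1 < p) (hc : 0 ≤ c) {a b : ℝ} (hab : a < b) {f : ℝ → X}
    (hf : AEStronglyMeasurable f (volume.restrict (Ioo a b))) {M : ℝ}
    (hfM : ∀ x, ‖f x‖ ≤ M) :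
    ∑' k : ℤ, ecarlesonAvg f a b k ^ (p / (p - 1)) ≤
      ENNReal.ofReal (c * M) ^ (p / (p - 1)) := by
  have hq : 1 ≤ p / (p - 1) := by
    rw [le_div_iff₀ (by linarith)]
    linarith
  calc ∑' k : ℤ, ecarlesonAvg f a b k ^ (p / (p - 1))
      ≤ ∑' (k : ℤ) (μ : ℤ), carlesonWeight μ *
          ‖intervalFourierCoeff f a b ((k : ℝ) + (μ : ℝ) / 3)‖ₑ ^ (p / (p - 1)) :=
        ENNReal.tsum_le_tsum fun k => tsum_mul_rpow_le _ _ tsum_carlesonWeight.le hq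
    _ = ∑' μ : ℤ, carlesonWeight μ * ∑' k : ℤ,
          ‖intervalFourierCoeff f a b ((k : ℝ) + (μ : ℝ) / 3)‖ₑ ^ (p / (p - 1)) := by
        rw [ENNReal.tsum_comm]
        simp only [ENNReal.tsum_mul_left]
    _ ≤ ∑' μ : ℤ, carlesonWeight μ * ENNReal.ofReal (c * M) ^ (p / (p - 1)) :=
        ENNReal.tsum_le_tsum fun μ => mul_le_mul_right (hX.tsum_rpow_le hp hc hab hf hfM _) _
    _ = ENNReal.ofReal (c * M) ^ (p / (p - 1)) := by
        rw [ENNReal.tsum_mul_right, tsum_carlesonWeight, one_mul]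

lemma ofReal_carlesonAvg_le_truncation_add {a b : ℝ} (hab : a < b) {f : ℝ → X}
    (hf : AEStronglyMeasurable f (volume.restrict (Ioo a b))) {β lam s : ℝ} (hβ : 0 < β)
    (hs : 0 < s) (h : avgLlogL f β a b ≤ ENNReal.ofReal lam) (k : ℤ) :
    ENNReal.ofReal (carlesonAvg f a b k) ≤
      ecarlesonAvg (normTruncation f (Real.exp s)) a b k + ENNReal.ofReal ((s ^ β)⁻¹ * lam) := by
  have hg : IntegrableOn (normTruncation f (Real.exp s)) (Ioo a b) :=
    Integrable.of_bound (aestronglyMeasurable_normTruncation hf _) (Real.exp s)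
      (Eventually.of_forall fun x => norm_normTruncation_le f (Real.exp_pos s).le x)
  refine (ofReal_carlesonAvg_le f a b k).trans
    ((ecarlesonAvg_le_add hab hf hg k).trans (add_le_add_right ?_ _))
  calc (ENNReal.ofReal (b - a))⁻¹ * ∫⁻ t in Ioo a b, ‖f t - normTruncation f (Real.exp s) t‖ₑ
      ≤ (ENNReal.ofReal (b - a))⁻¹ * ∫⁻ t in Ioo a b, ENNReal.ofReal (s ^ β)⁻¹ *
          ENNReal.ofReal (‖f t‖ * logPlus ‖f t‖ ^ β) := by
        gcongr with t
        exact enorm_sub_normTruncation_le f hβ hs t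
    _ = ENNReal.ofReal (s ^ β)⁻¹ * avgLlogL f β a b := by
        rw [lintegral_const_mul' _ _ ENNReal.ofReal_ne_top, avgLlogL, mul_left_comm]
    _ ≤ ENNReal.ofReal ((s ^ β)⁻¹ * lam) := by
        rw [ENNReal.ofReal_mul (by positivity)]
        gcongr

/-- The coefficient of the `n`-th truncation in the estimate of `expWeight`. -/
def truncationWeight (q β lam : ℝ) (n : ℕ) : ℝ :=
  Real.exp (-(q + 1) * (n - 1)) * ((n : ℝ) ^ β / lam) ^ q

lemma truncationWeight_nonneg {q β lam : ℝ} (hlam : 0 < lam) (n : ℕ) :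
    0 ≤ truncationWeight q β lam n := by
  unfold truncationWeight
  positivity

lemma summable_truncationWeight {q β lam c : ℝ} (hq : 0 < q) (hβ : 0 < β) (hlam : 0 < lam)
    (hc : 0 < c) :
    Summable fun n : ℕ => truncationWeight q β lam n * (c * Real.exp n) ^ q := by
  have hs : Summable fun n : ℕ => (Real.exp (q + 1) * (c / lam) ^ q) *
      ((n : ℝ) ^ ⌈β * q⌉₊ * Real.exp (-1 * n)) :=
    (Real.summable_pow_mul_exp_neg_nat_mul _ one_pos).mul_left _
  refine Summable.of_nonneg_of_le
    (fun n => mul_nonneg (truncationWeight_nonneg hlam n) (by positivity)) (fun n => ?_) hs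
  have hpow : (n : ℝ) ^ (β * q) ≤ (n : ℝ) ^ ⌈β * q⌉₊ := by
    rcases Nat.eq_zero_or_pos n with rfl | hn
    · rw [Nat.cast_zero, Real.zero_rpow (by positivity)]
      positivity
    · rw [← Real.rpow_natCast]
      exact Real.rpow_le_rpow_of_exponent_le (by exact_mod_cast hn) (Nat.le_ceil _)
  have heq : truncationWeight q β lam n * (c * Real.exp n) ^ q =
      (Real.exp (q + 1) * (c / lam) ^ q) * ((n : ℝ) ^ (β * q) * Real.exp (-1 * n)) := by
    have he : Real.exp (-(q + 1) * (n - 1)) * Real.exp (n * q) =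
        Real.exp (q + 1) * Real.exp (-1 * n) := by
      rw [← Real.exp_add, ← Real.exp_add]
      congr 1
      ring
    rw [truncationWeight, Real.div_rpow (by positivity) hlam.le, ← Real.rpow_mul (by positivity),
      Real.mul_rpow hc.le (by positivity), ← Real.exp_mul, Real.div_rpow hc.le hlam.le]
    linear_combination ((n : ℝ) ^ (β * q) * c ^ q / lam ^ q) * he
  rw [heq]
  gcongr

/-- If `t > 0` is at most `E n + n ^ (-β) * lam` for every `n ≥ 1`, then its weight is controlled by
the `E n`. -/
lemma ofReal_expWeight_le_tsum {q β lam t : ℝ} (hq : 0 < q) (hβ : 0 < β) (hlam : 0 < lam)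
    (ht : 0 ≤ t) {E : ℕ → ℝ≥0∞}
    (hE : ∀ n : ℕ, 0 < n → ENNReal.ofReal t ≤ E n + ENNReal.ofReal (((n : ℝ) ^ β)⁻¹ * lam)) :
    ENNReal.ofReal (expWeight ((q + 1) * (2 * lam) ^ (1 / β)) β t) ≤
      ∑' n : ℕ, ENNReal.ofReal (truncationWeight q β lam n) * E n ^ q := by
  rcases ht.eq_or_lt with rfl | ht
  · simp [expWeight]
  set r := (2 * lam) ^ (1 / β) * t ^ (-(1 / β)) with hr
  have hrpos : 0 < r := by positivity
  set n := ⌈r⌉₊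
  have hn : 0 < n := Nat.ceil_pos.2 hrpos
  have hn' : (0 : ℝ) < n := by exact_mod_cast hn
  have hrn : r ≤ n := Nat.le_ceil r
  have hnr : (n : ℝ) - 1 ≤ r := by
    have := Nat.ceil_lt_add_one hrpos.le
    linarith
  have hrβ : r ^ β = 2 * lam / t := by
    rw [hr, Real.mul_rpow (by positivity) (by positivity), ← Real.rpow_mul (by positivity),
      ← Real.rpow_mul ht.le, neg_mul, one_div_mul_cancel hβ.ne', Real.rpow_one,
      Real.rpow_neg_one, div_eq_mul_inv]
  have hnβ : 2 * lam / t ≤ (n : ℝ) ^ β := hrβ ▸ Real.rpow_le_rpow hrpos.le hrn hβ.le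
  have hnβ0 : 0 < (n : ℝ) ^ β := by positivity
  rw [div_le_iff₀ ht] at hnβ
  refine le_trans ?_ (ENNReal.le_tsum n)
  have htE : ENNReal.ofReal (((n : ℝ) ^ β)⁻¹ * lam) ≤ E n := by
    have h1 : 2 * (((n : ℝ) ^ β)⁻¹ * lam) ≤ t := by
      rw [← mul_assoc, mul_right_comm, ← div_eq_mul_inv, div_le_iff₀ hnβ0]
      linarith
    have h2 := (ENNReal.ofReal_le_ofReal h1).trans (hE n hn)
    rw [two_mul, ENNReal.ofReal_add (by positivity) (by positivity)] at h2
    exact (ENNReal.add_le_add_iff_right ENNReal.ofReal_ne_top).1 h2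
  have hexp : expWeight ((q + 1) * (2 * lam) ^ (1 / β)) β t ≤ Real.exp (-(q + 1) * (n - 1)) := by
    rw [expWeight, if_neg ht.ne', Real.exp_le_exp]
    have : (q + 1) * ((n : ℝ) - 1) ≤ (q + 1) * r := by gcongr
    rw [hr] at this
    linarith
  calc ENNReal.ofReal (expWeight ((q + 1) * (2 * lam) ^ (1 / β)) β t)
      ≤ ENNReal.ofReal (Real.exp (-(q + 1) * (n - 1))) := ENNReal.ofReal_le_ofReal hexp
    _ = ENNReal.ofReal (truncationWeight q β lam n) *
          ENNReal.ofReal (((n : ℝ) ^ β)⁻¹ * lam) ^ q := by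
        rw [ENNReal.ofReal_rpow_of_nonneg (by positivity) hq.le,
          ← ENNReal.ofReal_mul (truncationWeight_nonneg hlam n), truncationWeight, mul_assoc,
          ← Real.mul_rpow (by positivity) (by positivity)]
        congr 1
        field_simp
        simp
    _ ≤ ENNReal.ofReal (truncationWeight q β lam n) * E n ^ q := by gcongr

end

/-- Lemma 4.1: if `X` has Fourier type `p ∈ (1,2]` with constant `c_p`, `δ > 0`,
`λ > 0`, then there are `b(λ,δ), B(λ,δ) > 0` (depending only on `λ, δ, p, c_p`) such that for
every finite interval `w` and every `f` with `(1/|w|)∫_w ‖f‖(log⁺‖f‖)^{1+δ} ≤ λ`,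
`Σ_k exp(-b · C_k(f,w)^{-1/(1+δ)}) ≤ B`. -/
theorem statement13 (p cp δ lam : ℝ) (hp1 : 1 < p) (hp2 : p ≤ 2) (hcp : 0 < cp)
    (hδ : 0 < δ) (hlam : 0 < lam) :
    ∃ b B : ℝ, 0 < b ∧ 0 < B ∧
      ∀ (X : Type u) [NormedAddCommGroup X] [NormedSpace ℂ X] [CompleteSpace X],
        HasFourierTypeWith X p cp →
        ∀ w₁ w₂ : ℝ, w₁ < w₂ → ∀ f : ℝ → X,
          AEStronglyMeasurable f (volume.restrict (Ioo w₁ w₂)) →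
          avgLlogL f (1 + δ) w₁ w₂ ≤ ENNReal.ofReal lam →
          (∑' k : ℤ, ENNReal.ofReal (expWeight b (1 + δ) (carlesonAvg f w₁ w₂ k))) ≤
            ENNReal.ofReal B := by
  have hq : 0 < p / (p - 1) := div_pos (by linarith) (by linarith)
  have hβ : 0 < 1 + δ := by linarith
  set q := p / (p - 1)
  have hsum := summable_truncationWeight hq hβ hlam hcp
  have hnn : ∀ n : ℕ, 0 ≤ truncationWeight q (1 + δ) lam n * (cp * Real.exp n) ^ q := fun n =>
    mul_nonneg (truncationWeight_nonneg hlam n) (by positivity)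
  refine ⟨(q + 1) * (2 * lam) ^ (1 / (1 + δ)),
    (∑' n : ℕ, truncationWeight q (1 + δ) lam n * (cp * Real.exp n) ^ q) + 1, by positivity,
    add_pos_of_nonneg_of_pos (tsum_nonneg hnn) one_pos, ?_⟩
  intro X _ _ _ hX a b hab f hf hfavg
  let E : ℕ → ℤ → ℝ≥0∞ := fun n k => ecarlesonAvg (normTruncation f (Real.exp n)) a b k
  calc ∑' k : ℤ, ENNReal.ofReal (expWeight ((q + 1) * (2 * lam) ^ (1 / (1 + δ))) (1 + δ)
        (carlesonAvg f a b k))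
      ≤ ∑' (k : ℤ) (n : ℕ), ENNReal.ofReal (truncationWeight q (1 + δ) lam n) * E n k ^ q :=
        ENNReal.tsum_le_tsum fun k => ofReal_expWeight_le_tsum hq hβ hlam
          (carlesonAvg_nonneg f a b k) fun n hn =>
            ofReal_carlesonAvg_le_truncation_add hab hf hβ (by exact_mod_cast hn) hfavg k
    _ = ∑' n : ℕ, ENNReal.ofReal (truncationWeight q (1 + δ) lam n) * ∑' k : ℤ, E n k ^ q := by
        rw [ENNReal.tsum_comm]
        simp only [ENNReal.tsum_mul_left]
    _ ≤ ∑' n : ℕ, ENNReal.ofReal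
          (truncationWeight q (1 + δ) lam n * (cp * Real.exp n) ^ q) := by
        refine ENNReal.tsum_le_tsum fun n => ?_
        rw [ENNReal.ofReal_mul (truncationWeight_nonneg hlam n),
          ← ENNReal.ofReal_rpow_of_nonneg (by positivity) hq.le]
        exact mul_le_mul_right (hX.tsum_ecarlesonAvg_rpow_le hp1 hcp.le hab
          (aestronglyMeasurable_normTruncation hf _)
          (norm_normTruncation_le f (Real.exp_pos _).le)) _
    _ ≤ _ := by
        rw [← ENNReal.ofReal_tsum_of_nonneg hnn hsum]
        exact ENNReal.ofReal_le_ofReal (by linarith)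

end
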